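/- arXiv:2001.01688 — 3 statements merged into one kernel-verified Lean document; each statement's English description precedes it below -/
import Mathlib

section
/- Let g be a real Lie algebra, V a finite-dimensional real vector space carrying an irreducible g-module structure, and B a nondegenerate symmetric bilinear form on V which is g-invariant, i.e. B(⁅x,v⁆,w) + B(v,⁅x,w⁆) = 0 for all x ∈ g and v,w ∈ V. Then the subspace V₀ of all linear maps A : V → V that are skew-adjoint with respect to B (B(Av,w) = −B(v,Aw) for all v,w ∈ V) and commute with the g-action (A(⁅x,v⁆) = ⁅x, A v⁆ for all x ∈ g, v ∈ V) has real dimension at most 4. -/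
section RealDivisionAlgebra

variable {D : Type*} [Ring D] [IsDomain D] [Algebra ℝ D]

theorem exists_sub_algebraMap_sq_eq [FiniteDimensional ℝ D] (x : D) :
    ∃ a d : ℝ, (x - algebraMap ℝ D a) ^ 2 = algebraMap ℝ D d := by
  have hint : IsIntegral ℝ x := Algebra.IsIntegral.isIntegral x
  have hirr := minpoly.irreducible hint
  have hq := Polynomial.eq_quadratic_of_degree_le_two hirr.degree_le_two
  have h0 := minpoly.aeval ℝ x
  have hne := hirr.ne_zero
  generalize minpoly ℝ x = p at *
  generalize p.coeff 2 = a at *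
  generalize p.coeff 1 = b at *
  generalize p.coeff 0 = c at *
  subst hq
  have h : a • x ^ 2 + b • x + c • (1 : D) = 0 := by
    simpa [Algebra.smul_def] using h0
  by_cases ha : a = 0
  · subst ha
    have hb : b ≠ 0 := by
      rintro rfl
      have hc : c = 0 := by simpa using h
      simp [hc] at hne
    refine ⟨-c / b, 0, ?_⟩
    have hx : x = algebraMap ℝ D (-c / b) := by
      have h' : b • x = (-c) • (1 : D) := by
        rw [neg_smul]; exact eq_neg_of_add_eq_zero_left (by simpa using h)
      rw [Algebra.algebraMap_eq_smul_one, div_eq_inv_mul, mul_smul, ← h', smul_smul,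
        inv_mul_cancel₀ hb, one_smul]
    rw [← hx]
    simp
  · refine ⟨-b / (2 * a), (b / (2 * a)) ^ 2 - c / a, ?_⟩
    have hx : x ^ 2 = (-b / a) • x - (c / a) • (1 : D) := by
      have h' : a⁻¹ • (a • x ^ 2 + b • x + c • (1 : D)) = 0 := by rw [h, smul_zero]
      rw [smul_add, smul_add, smul_smul, smul_smul, smul_smul, inv_mul_cancel₀ ha, one_smul] at h'
      rw [← sub_eq_zero, ← h']
      match_scalars <;> ring
    simp only [Algebra.algebraMap_eq_smul_one, sq, sub_mul, mul_sub, smul_mul_assoc, mul_smul_comm,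
      one_mul, mul_one] at hx ⊢
    rw [hx]
    match_scalars <;> field_simp <;> ring

theorem mem_span_one_pair_of_commute [FiniteDimensional ℝ D] {i x : D} (hi : i * i = -1)
    (h : Commute x i) : x ∈ Submodule.span ℝ {1, i} := by
  obtain ⟨a, d, had⟩ := exists_sub_algebraMap_sq_eq x
  rw [Submodule.mem_span_pair]
  have hy : Commute (x - algebraMap ℝ D a) i := h.sub_left (Algebra.commute_algebraMap_left a i)
  rcases le_total 0 d with hd | hd
  · have hs : (x - algebraMap ℝ D a) ^ 2 = (algebraMap ℝ D (√d)) ^ 2 := by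
      rw [had, ← map_pow, Real.sq_sqrt hd]
    rcases (Algebra.commute_algebraMap_right (√d) _).sq_eq_sq_iff_eq_or_eq_neg.1 hs with h | h
    · exact ⟨a + √d, 0, by
        rw [sub_eq_iff_eq_add] at h
        rw [h]
        simp only [Algebra.algebraMap_eq_smul_one]
        module⟩
    · exact ⟨a - √d, 0, by
        rw [sub_eq_iff_eq_add] at h
        rw [h]
        simp only [Algebra.algebraMap_eq_smul_one]
        module⟩
  · have hs : (x - algebraMap ℝ D a) ^ 2 = (√(-d) • i) ^ 2 := by
      rw [had, smul_pow, Real.sq_sqrt (neg_nonneg.2 hd), sq, hi, Algebra.algebraMap_eq_smul_one]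
      simp
    rcases (hy.smul_right (√(-d))).sq_eq_sq_iff_eq_or_eq_neg.1 hs with h | h
    · exact ⟨a, √(-d), by
        rw [sub_eq_iff_eq_add] at h
        rw [h, Algebra.algebraMap_eq_smul_one]
        module⟩
    · exact ⟨a, -√(-d), by
        rw [sub_eq_iff_eq_add] at h
        rw [h, Algebra.algebraMap_eq_smul_one]
        module⟩

theorem exists_mul_self_eq_neg_one_or_algebraMap_surjective [FiniteDimensional ℝ D] :
    (∃ i : D, i * i = -1) ∨ Function.Surjective (algebraMap ℝ D) := by
  refine or_iff_not_imp_left.2 fun hno x => ?_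
  obtain ⟨a, d, had⟩ := exists_sub_algebraMap_sq_eq x
  rcases le_or_gt 0 d with hd | hd
  · have hs : (x - algebraMap ℝ D a) ^ 2 = (algebraMap ℝ D (√d)) ^ 2 := by
      rw [had, ← map_pow, Real.sq_sqrt hd]
    rcases (Algebra.commute_algebraMap_right (√d) _).sq_eq_sq_iff_eq_or_eq_neg.1 hs with h | h
    · exact ⟨√d + a, by rw [map_add, ← h, sub_add_cancel]⟩
    · exact ⟨-√d + a, by rw [map_add, map_neg, ← h, sub_add_cancel]⟩
  · refine (hno ⟨(√(-d))⁻¹ • (x - algebraMap ℝ D a), ?_⟩).elim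
    rw [← sq, smul_pow, had, inv_pow, Real.sq_sqrt (by linarith), Algebra.algebraMap_eq_smul_one,
      smul_smul, ← neg_one_smul ℝ (1 : D)]
    congr 1
    field_simp [hd.ne]

variable (D) in
/-- The dimension bound in Frobenius's theorem on real division algebras. -/
theorem finrank_le_four_of_isDomain [FiniteDimensional ℝ D] : Module.finrank ℝ D ≤ 4 := by
  rcases exists_mul_self_eq_neg_one_or_algebraMap_surjective (D := D) with ⟨i, hi⟩ | hsurj
  · let c : D →ₗ[ℝ] D := LinearMap.mulRight ℝ i - LinearMap.mulLeft ℝ i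
    have hc (x : D) : c x = x * i - i * x := rfl
    have hker : Module.finrank ℝ (LinearMap.ker c) ≤ 2 := by
      have hle : LinearMap.ker c ≤ Submodule.span ℝ {1, i} := fun x hx =>
        mem_span_one_pair_of_commute hi (sub_eq_zero.1 ((hc x).symm.trans hx))
      classical
      have hcard := finrank_span_finset_le_card (R := ℝ) ({1, i} : Finset D)
      rw [Finset.coe_pair] at hcard
      exact (Submodule.finrank_mono hle).trans (hcard.trans Finset.card_le_two)
    have hanti {y : D} (hy : y ∈ LinearMap.range c) : y * i = -(i * y) := by
      obtain ⟨x, rfl⟩ := hy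
      rw [hc, sub_mul, mul_sub, mul_assoc x, hi, ← mul_assoc i i, hi, mul_assoc]
      simp [sub_eq_add_neg]
    have hrange : Module.finrank ℝ (LinearMap.range c) ≤ 2 := by
      rcases eq_or_ne (LinearMap.range c) ⊥ with hbot | hne
      · exact (Submodule.finrank_eq_zero.2 hbot).trans_le zero_le_two
      · obtain ⟨j, hj, hj0⟩ := Submodule.exists_mem_ne_zero_of_ne_bot hne
        have hinj : Function.Injective (LinearMap.mulRight ℝ j) := mul_left_injective₀ hj0
        rw [(Submodule.equivMapOfInjective _ hinj (LinearMap.range c)).finrank_eq]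
        refine (Submodule.finrank_mono ?_).trans hker
        rintro _ ⟨y, hy, rfl⟩
        rw [LinearMap.mem_ker, hc, LinearMap.mulRight_apply, mul_assoc, hanti hj, mul_neg,
          ← mul_assoc i, ← mul_assoc, hanti hy]
        simp [mul_assoc]
    have := c.finrank_range_add_finrank_ker
    omega
  · have := LinearMap.finrank_le_finrank_of_surjective (f := Algebra.linearMap ℝ D) hsurj
    rw [Module.finrank_self] at this
    omega

end RealDivisionAlgebra

section Schur

variable {R L M : Type*} [CommRing R] [LieRing L] [LieAlgebra R L] [AddCommGroup M] [Module R M]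
  [LieRingModule L M] [LieModule R L M]

/-- One half of Schur's lemma, for the commutant of an irreducible Lie algebra representation. -/
theorem noZeroDivisors_centralizer_range_toEnd [LieModule.IsIrreducible R L M] :
    NoZeroDivisors
      (Subalgebra.centralizer R (Set.range (LieModule.toEnd R L M) : Set (Module.End R M))) where
  eq_zero_or_eq_zero_of_mul_eq_zero := by
    rintro ⟨A, hA⟩ ⟨C, hC⟩ h
    have hAC : A * C = 0 := congrArg Subtype.val h
    have hcomm (x : L) (m : M) : A ⁅x, m⁆ = ⁅x, A m⁆ :=
      (LinearMap.congr_fun (hA _ ⟨x, rfl⟩) m).symm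
    let N : LieSubmodule R L M :=
      { LinearMap.ker A with
        lie_mem := fun {x m} hm => by
          have hm' : A m = 0 := hm
          change A ⁅x, m⁆ = 0
          rw [hcomm, hm', lie_zero] }
    have hN (m : M) : m ∈ N ↔ A m = 0 := Iff.rfl
    rcases eq_bot_or_eq_top N with hbot | htop
    · right
      ext m
      have : C m ∈ N := LinearMap.congr_fun hAC m
      simpa [hbot] using this
    · left
      ext m
      exact (hN m).1 (htop ▸ LieSubmodule.mem_top m)

end Schur


/-- (Proposition 5.1 of the paper.) Let `V` be an irreducible finite-dimensional
real module over a real Lie algebra `g`, with a nondegenerate symmetric `g`-invariant bilinear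
form `B`. Then the space `V₀` of linear maps `V → V` that are `B`-skew-adjoint and commute with
the `g`-action has dimension at most `4`. -/
theorem finrank_skew_commuting_endomorphisms_le_four
    (g : Type*) [LieRing g] [LieAlgebra ℝ g]
    (V : Type*) [AddCommGroup V] [Module ℝ V] [FiniteDimensional ℝ V]
    [LieRingModule g V] [LieModule ℝ g V]
    (hirr : Nontrivial V ∧ ∀ W : LieSubmodule ℝ g V, W = ⊥ ∨ W = ⊤)
    (B : LinearMap.BilinForm ℝ V)
    (hsymm : ∀ v w : V, B v w = B w v)
    (hnondeg : ∀ v : V, (∀ w : V, B v w = 0) → v = 0)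
    (hinv : ∀ (x : g) (v w : V), B ⁅x, v⁆ w + B v ⁅x, w⁆ = 0)
    (V₀ : Submodule ℝ (V →ₗ[ℝ] V))
    (hV₀ : ∀ A : V →ₗ[ℝ] V, A ∈ V₀ ↔
      (∀ v w : V, B (A v) w = - B v (A w)) ∧
      (∀ (x : g) (v : V), A ⁅x, v⁆ = ⁅x, A v⁆)) :
    Module.finrank ℝ V₀ ≤ 4 := by
  have := hirr.1
  have : LieModule.IsIrreducible ℝ g V :=
    LieModule.IsIrreducible.mk fun N h => (hirr.2 N).resolve_left h
  let D := Subalgebra.centralizer ℝ (Set.range (LieModule.toEnd ℝ g V) : Set (Module.End ℝ V))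
  have : NoZeroDivisors D := noZeroDivisors_centralizer_range_toEnd
  have : IsDomain D := NoZeroDivisors.to_isDomain D
  have hle : V₀ ≤ Subalgebra.toSubmodule D := by
    rintro A hA _ ⟨x, rfl⟩
    ext v
    exact (((hV₀ A).1 hA).2 x v).symm
  exact (Submodule.finrank_mono hle).trans (finrank_le_four_of_isDomain D)
end

section
/- Let h be a finite-dimensional real Lie algebra with trivial radical (i.e. h is semisimple). Suppose g ⊆ h is a Lie subalgebra which is a simple Lie algebra, and V ⊆ h is a subspace with h = g ⊕ V as vector spaces and ⁅g,V⁆ ⊆ V. Assume that V, viewed as a g-module via v ↦ ⁅x,v⁆, is irreducible, nontrivial (⁅g,V⁆ ≠ 0), and not isomorphic to the adjoint module of g. Then h is a simple Lie algebra. -/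
/-- Schur's lemma for equivariant maps from a simple Lie subalgebra to an irreducible submodule
which is not isomorphic to the adjoint module. -/
theorem LieSubalgebra.eq_zero_of_not_adjoint {k L : Type*} [CommRing k] [LieRing L]
    [LieAlgebra k L] (g : LieSubalgebra k L) [LieAlgebra.IsSimple k g] (V : Submodule k L)
    (hirrV : ∀ W : Submodule k L, W ≤ V → (∀ x ∈ g, ∀ w ∈ W, ⁅x, w⁆ ∈ W) → W = ⊥ ∨ W = V)
    (hnotadj : ¬ ∃ e : g ≃ₗ[k] V, ∀ x y : g, (e ⁅x, y⁆ : L) = ⁅(x : L), (e y : L)⁆)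
    (f : g →ₗ[k] V) (hf : ∀ x y : g, (f ⁅x, y⁆ : L) = ⁅(x : L), (f y : L)⁆) : f = 0 := by
  let K : LieIdeal k g :=
    { LinearMap.ker f with
      lie_mem := by
        intro x y hy
        have hy' : f y = 0 := hy
        change f ⁅x, y⁆ = 0
        apply Subtype.ext
        rw [hf, hy']
        simp }
  have hK : ∀ x, x ∈ K ↔ f x = 0 := fun _ => Iff.rfl
  rcases LieAlgebra.IsSimple.eq_bot_or_eq_top (R := k) K with h | h
  · have hinj : Function.Injective f := by
      rw [injective_iff_map_eq_zero]
      intro x hx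
      rwa [← hK, h, LieSubmodule.mem_bot] at hx
    rcases hirrV ((LinearMap.range f).map V.subtype) (Submodule.map_subtype_le _ _) (by
        rintro x hx _ ⟨_, ⟨y, rfl⟩, rfl⟩
        exact ⟨f ⁅(⟨x, hx⟩ : g), y⁆, ⟨_, rfl⟩, hf ⟨x, hx⟩ y⟩) with hW | hW
    · apply LinearMap.range_eq_bot.mp
      exact Submodule.map_injective_of_injective V.injective_subtype (hW.trans (Submodule.map_bot _).symm)
    · have hsurj : Function.Surjective f := by
        intro v
        have hv : (v : L) ∈ (LinearMap.range f).map V.subtype := by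
          rw [hW]
          exact v.2
        obtain ⟨_, ⟨y, rfl⟩, hy⟩ := hv
        exact ⟨y, Subtype.ext hy⟩
      exact absurd ⟨LinearEquiv.ofBijective f ⟨hinj, hsurj⟩, hf⟩ hnotadj
  · ext x
    have hx : x ∈ K := h ▸ LieSubmodule.mem_top x
    rw [(hK x).mp hx]
    rfl

/-- An ideal meeting `V` trivially vanishes, where `V` is a stable complement of a simple
subalgebra `g` that acts nontrivially on `V` and admits no nonzero equivariant map to `V`. -/
theorem LieIdeal.eq_bot_of_inf_eq_bot {k L : Type*} [CommRing k] [LieRing L]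
    [LieAlgebra k L] (g : LieSubalgebra k L) [LieAlgebra.IsSimple k g] (V : Submodule k L)
    (hsup : g.toSubmodule ⊔ V = ⊤)
    (hstab : ∀ x ∈ g, ∀ v ∈ V, ⁅x, v⁆ ∈ V)
    (hnontriv : ∃ x ∈ g, ∃ v ∈ V, ⁅x, v⁆ ≠ 0)
    (hzero : ∀ f : g →ₗ[k] V, (∀ x y : g, (f ⁅x, y⁆ : L) = ⁅(x : L), (f y : L)⁆) → f = 0)
    (I : LieIdeal k L) (hI : I.toSubmodule ⊓ V = ⊥) : I = ⊥ := by
  have hsupstab : ∀ x ∈ g, ∀ y ∈ I.toSubmodule ⊔ V, ⁅x, y⁆ ∈ I.toSubmodule ⊔ V := by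
    intro x hx y hy
    obtain ⟨i, hi, v, hv, rfl⟩ := Submodule.mem_sup.mp hy
    rw [lie_add]
    exact Submodule.add_mem_sup (I.lie_mem hi) (hstab x hx v hv)
  let K : LieIdeal k g :=
    { (I.toSubmodule ⊔ V).comap g.toSubmodule.subtype with
      lie_mem := fun {x y} hy => hsupstab x x.2 y hy }
  have hK : ∀ x, x ∈ K ↔ (x : L) ∈ I.toSubmodule ⊔ V := fun _ => Iff.rfl
  rcases LieAlgebra.IsSimple.eq_bot_or_eq_top (R := k) K with h | h
  · have hle : I.toSubmodule ≤ V := by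
      intro i hi
      obtain ⟨x, hx, v, hv, rfl⟩ := Submodule.mem_sup.mp (hsup ▸ Submodule.mem_top : i ∈ _ ⊔ V)
      have hxK : (⟨x, hx⟩ : g) ∈ K := by
        rw [hK]
        simpa using sub_mem (Submodule.mem_sup_left hi : x + v ∈ I.toSubmodule ⊔ V)
          (Submodule.mem_sup_right hv)
      rw [h, LieSubmodule.mem_bot] at hxK
      have hx0 : x = 0 := congrArg Subtype.val hxK
      simpa [hx0] using hv
    rw [inf_eq_left.mpr hle] at hI
    exact (LieSubmodule.toSubmodule_eq_bot I).mp hI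
  · have hgle : g.toSubmodule ≤ I.toSubmodule ⊔ V := fun x hx =>
      (hK ⟨x, hx⟩).mp (h ▸ LieSubmodule.mem_top _)
    have hc : IsCompl V I.toSubmodule := by
      refine IsCompl.of_eq (by rw [inf_comm, hI]) ?_
      rw [sup_comm, eq_top_iff, ← hsup]
      exact sup_le hgle le_sup_right
    let p := V.projectionOnto I.toSubmodule hc
    have hsub : ∀ y, y - (p y : L) ∈ I := by
      intro y
      have : y - (p y : L) ∈ LinearMap.ker p := by
        rw [LinearMap.mem_ker, map_sub, Submodule.projectionOnto_apply_left, sub_self]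
      rwa [Submodule.ker_projectionOnto] at this
    have hp : p ∘ₗ g.toSubmodule.subtype = 0 := by
      apply hzero
      intro x y
      have h1 : (⁅(x : L), (y : L)⁆ - (p ⁅(x : L), (y : L)⁆ : L)) ∈ I := hsub _
      have h2 : ⁅(x : L), (y : L) - (p (y : L) : L)⁆ ∈ I := I.lie_mem (hsub _)
      rw [lie_sub] at h2
      have h3 := sub_mem h2 h1
      rw [sub_sub_sub_cancel_left] at h3
      have h4 := sub_mem (p ⁅(x : L), (y : L)⁆).2 (hstab x x.2 _ (p (y : L)).2)
      have h5 : _ ∈ I.toSubmodule ⊓ V := ⟨h3, h4⟩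
      rw [hI, Submodule.mem_bot, sub_eq_zero] at h5
      exact h5
    obtain ⟨x, hx, v, hv, hxv⟩ := hnontriv
    have hpx : p x = 0 := LinearMap.congr_fun hp ⟨x, hx⟩
    have hxI : x ∈ I := by simpa [hpx] using hsub x
    have hmem : ⁅x, v⁆ ∈ I.toSubmodule ⊓ V := ⟨lie_mem_left k L I x v hxI, hstab x hx v hv⟩
    rw [hI, Submodule.mem_bot] at hmem
    exact absurd hmem hxv

/-- Let `h` be a finite-dimensional semisimple real Lie algebra (trivial
radical), `g ⊆ h` a simple Lie subalgebra and `V ⊆ h` a complementary subspace with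
`⁅g,V⁆ ⊆ V` which, as a `g`-module, is irreducible, nontrivial, and not isomorphic to the
adjoint module of `g`.  Then `h` is simple. -/
theorem simple_of_semisimple_decomposition
    (h : Type*) [LieRing h] [LieAlgebra ℝ h] [Module.Finite ℝ h]
    (hrad : LieAlgebra.radical ℝ h = ⊥)
    (g : LieSubalgebra ℝ h) [LieAlgebra.IsSimple ℝ g]
    (V : Submodule ℝ h)
    (hcompl : g.toSubmodule ⊓ V = ⊥ ∧ g.toSubmodule ⊔ V = ⊤)
    (hstab : ∀ x ∈ g, ∀ v ∈ V, ⁅x, v⁆ ∈ V)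
    (hVne : V ≠ ⊥)
    (hirrV : ∀ W : Submodule ℝ h, W ≤ V → (∀ x ∈ g, ∀ w ∈ W, ⁅x, w⁆ ∈ W) →
      W = ⊥ ∨ W = V)
    (hnontriv : ∃ x ∈ g, ∃ v ∈ V, ⁅x, v⁆ ≠ 0)
    (hnotadj : ¬ ∃ e : g ≃ₗ[ℝ] V, ∀ x y : g, (e ⁅x, y⁆ : h) = ⁅(x : h), (e y : h)⁆) :
    LieAlgebra.IsSimple ℝ h := by
  have key := LieIdeal.eq_bot_of_inf_eq_bot g V hcompl.2 hstab hnontriv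
    (LieSubalgebra.eq_zero_of_not_adjoint g V hirrV hnotadj)
  have : LieAlgebra.HasTrivialRadical ℝ h := ⟨hrad⟩
  refine ⟨fun I => ?_, fun hab => ?_⟩
  · rcases hirrV (I.toSubmodule ⊓ V) inf_le_right
      (fun x hx w hw => ⟨I.lie_mem hw.1, hstab x hx w hw.2⟩) with hI | hI
    · exact Or.inl (key I hI)
    · right
      have hc := LieIdeal.isCompl_killingCompl I
      have hJ : LieIdeal.killingCompl ℝ h I = ⊥ := by
        apply key
        rw [eq_bot_iff]
        rintro x ⟨hxJ, hxV⟩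
        have hxI : x ∈ I := inf_eq_right.mp hI hxV
        have hx : x ∈ I ⊓ LieIdeal.killingCompl ℝ h I := ⟨hxI, hxJ⟩
        rw [hc.inf_eq_bot] at hx
        exact hx
      simpa [hJ] using hc.sup_eq_top
  · obtain ⟨x, -, v, -, hxv⟩ := hnontriv
    exact hxv (trivial_lie_zero h h x v)
end

section
/- Let h be a finite-dimensional real Lie algebra, g ⊆ h a Lie subalgebra which is a simple Lie algebra, and V ⊆ h a subspace with h = g ⊕ V as vector spaces and ⁅g,V⁆ ⊆ V. Assume that V, viewed as a g-module via v ↦ ⁅x,v⁆, is irreducible, nontrivial (⁅g,V⁆ ≠ 0), and not isomorphic to the adjoint module of g. If the radical of h is nonzero, then the radical of h equals V and ⁅V,V⁆ = 0; in particular V is an abelian ideal of h and h is the semidirect product of g acting on V. -/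
/-- A solvable ideal meets a simple subalgebra trivially. -/
theorem LieIdeal.inf_eq_bot_of_isSolvable {K L : Type*} [Field K] [LieRing L] [LieAlgebra K L]
    (g : LieSubalgebra K L) [LieAlgebra.IsSimple K g] (I : LieIdeal K L)
    [LieAlgebra.IsSolvable I] : g.toSubmodule ⊓ I.toSubmodule = ⊥ := by
  rcases LieAlgebra.IsSimple.eq_bot_or_eq_top (LieIdeal.comap g.incl I) with hI | hI
  · rw [eq_bot_iff]
    rintro x ⟨hxg, hxI⟩
    have hx : (⟨x, hxg⟩ : g) ∈ LieIdeal.comap g.incl I := LieIdeal.mem_comap.mpr hxI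
    rw [hI, LieSubmodule.mem_bot] at hx
    exact congrArg Subtype.val hx
  · have hmem (x : g) : (x : L) ∈ I :=
      LieIdeal.mem_comap.mp (hI ▸ LieSubmodule.mem_top x : x ∈ LieIdeal.comap g.incl I)
    let f : g →ₗ⁅K⁆ I :=
      { toFun := fun x => ⟨x, hmem x⟩
        map_add' := fun _ _ => rfl
        map_smul' := fun _ _ => rfl
        map_lie' := rfl }
    have hf : Function.Injective f := fun x y hxy =>
      Subtype.ext (congrArg (fun z : I => (z : L)) hxy)
    have hsolv : LieAlgebra.IsSolvable g := hf.lieAlgebra_isSolvable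
    have htop : (⊤ : LieIdeal K g) = ⊥ := by
      rw [← LieAlgebra.radical_eq_top_of_isSolvable K g, LieAlgebra.radical_eq_bot]
    refine absurd ⟨fun x y => ?_⟩ (LieAlgebra.IsSimple.non_abelian K (L := g))
    have hxy : ⁅x, y⁆ ∈ (⊤ : LieIdeal K g) := LieSubmodule.mem_top _
    rwa [htop, LieSubmodule.mem_bot] at hxy

/-- The projection onto an invariant subspace along an invariant complement is equivariant. -/
theorem Submodule.projection_lie_of_isCompl {K L : Type*} [Field K] [LieRing L] [LieAlgebra K L]
    {p q : Submodule K L} (hpq : IsCompl p q) {x : L} (hp : ∀ y ∈ p, ⁅x, y⁆ ∈ p)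
    (hq : ∀ y ∈ q, ⁅x, y⁆ ∈ q) (y : L) :
    (p.projectionOnto q hpq ⁅x, y⁆ : L) = ⁅x, (p.projectionOnto q hpq y : L)⁆ := by
  obtain ⟨a, ha, b, hb, rfl⟩ := Submodule.mem_sup.mp
    (hpq.sup_eq_top ▸ Submodule.mem_top : y ∈ p ⊔ q)
  rw [lie_add, map_add, map_add, Submodule.projectionOnto_apply_of_mem_left hpq ha,
    Submodule.projectionOnto_apply_of_mem_left hpq (hp a ha),
    Submodule.projectionOnto_apply_of_mem_right hpq hb,
    Submodule.projectionOnto_apply_of_mem_right hpq (hq b hb)]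
  simp

/-- A subalgebra and an invariant subspace with a common complementary ideal are isomorphic as
modules over the subalgebra. -/
theorem LieSubalgebra.exists_equiv_of_isCompl {K L : Type*} [Field K] [LieRing L] [LieAlgebra K L]
    (g : LieSubalgebra K L) (V : Submodule K L) (I : LieIdeal K L)
    (hstab : ∀ x ∈ g, ∀ v ∈ V, ⁅x, v⁆ ∈ V) (hg : IsCompl g.toSubmodule I.toSubmodule)
    (hV : IsCompl V I.toSubmodule) :
    ∃ e : g ≃ₗ[K] V, ∀ x y : g, (e ⁅x, y⁆ : L) = ⁅(x : L), (e y : L)⁆ := by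
  let f : g →ₗ[K] V := (V.projectionOnto I.toSubmodule hV).comp g.toSubmodule.subtype
  have hinj : Function.Injective f := by
    refine (injective_iff_map_eq_zero f).mpr fun x hx => ?_
    have hxI : (x : L) ∈ I.toSubmodule :=
      (Submodule.projectionOnto_apply_eq_zero_iff hV).mp hx
    exact Subtype.ext ((Submodule.mem_bot K).mp (hg.inf_eq_bot ▸ ⟨x.2, hxI⟩))
  have hsurj : Function.Surjective f := by
    intro v
    obtain ⟨a, ha, b, hb, hab⟩ := Submodule.mem_sup.mp
      (hg.sup_eq_top ▸ Submodule.mem_top : (v : L) ∈ g.toSubmodule ⊔ I.toSubmodule)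
    refine ⟨⟨a, ha⟩, ?_⟩
    have hv := Submodule.projectionOnto_apply_left hV v
    rw [← hab, map_add, Submodule.projectionOnto_apply_of_mem_right hV hb, add_zero] at hv
    exact hv
  exact ⟨LinearEquiv.ofBijective f ⟨hinj, hsurj⟩, fun x y =>
    Submodule.projection_lie_of_isCompl hV (hstab x x.2) (fun z hz => I.lie_mem hz) y⟩


/-- In the decomposition `h = g ⊕ V` with `g` simple, `⁅g,V⁆ ⊆ V` and `V`
a nontrivial irreducible `g`-module not isomorphic to the adjoint module of `g`: if the
radical of `h` is nonzero, then the radical equals `V` and `⁅V,V⁆ = 0`, so `V` is an abelian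
ideal of `h`. -/
theorem radical_eq_of_nonsemisimple_decomposition
    (h : Type*) [LieRing h] [LieAlgebra ℝ h] [Module.Finite ℝ h]
    (g : LieSubalgebra ℝ h) [LieAlgebra.IsSimple ℝ g]
    (V : Submodule ℝ h)
    (hcompl : g.toSubmodule ⊓ V = ⊥ ∧ g.toSubmodule ⊔ V = ⊤)
    (hstab : ∀ x ∈ g, ∀ v ∈ V, ⁅x, v⁆ ∈ V)
    (hVne : V ≠ ⊥)
    (hirrV : ∀ W : Submodule ℝ h, W ≤ V → (∀ x ∈ g, ∀ w ∈ W, ⁅x, w⁆ ∈ W) →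
      W = ⊥ ∨ W = V)
    (hnontriv : ∃ x ∈ g, ∃ v ∈ V, ⁅x, v⁆ ≠ 0)
    (hnotadj : ¬ ∃ e : g ≃ₗ[ℝ] V, ∀ x y : g, (e ⁅x, y⁆ : h) = ⁅(x : h), (e y : h)⁆)
    (hrad : LieAlgebra.radical ℝ h ≠ ⊥) :
    (LieAlgebra.radical ℝ h).toSubmodule = V ∧
      (∀ v ∈ V, ∀ w ∈ V, ⁅v, w⁆ = 0) ∧
      (∀ x : h, ∀ v ∈ V, ⁅x, v⁆ ∈ V) := by
  set R := LieAlgebra.radical ℝ h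
  have hRg (x : h) (w : h) (hw : w ∈ R.toSubmodule) : ⁅x, w⁆ ∈ R.toSubmodule := R.lie_mem hw
  have hRne : R.toSubmodule ≠ ⊥ := fun hbot => hrad (by simpa using hbot)
  have hgR : g.toSubmodule ⊓ R.toSubmodule = ⊥ := LieIdeal.inf_eq_bot_of_isSolvable g R
  have hsup_stab {A B : Submodule ℝ h} (x : h) (hA : ∀ a ∈ A, ⁅x, a⁆ ∈ A)
      (hB : ∀ b ∈ B, ⁅x, b⁆ ∈ B) (w : h) (hw : w ∈ A ⊔ B) : ⁅x, w⁆ ∈ A ⊔ B := by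
    obtain ⟨a, ha, b, hb, rfl⟩ := Submodule.mem_sup.mp hw
    rw [lie_add]
    exact Submodule.add_mem_sup (hA a ha) (hB b hb)
  have hVR : V ≤ R.toSubmodule := by
    rcases hirrV (V ⊓ R.toSubmodule) inf_le_left
      (fun x hx w hw => ⟨hstab x hx w hw.1, hRg x w hw.2⟩) with hbot | heq
    swap
    · exact inf_eq_left.mp heq
    have htopg : g.toSubmodule ⊔ R.toSubmodule = ⊤ := by
      rcases hirrV (V ⊓ (g.toSubmodule ⊔ R.toSubmodule)) inf_le_left
        (fun x hx w hw => ⟨hstab x hx w hw.1,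
          hsup_stab x (fun a ha => g.lie_mem hx ha) (hRg x) w hw.2⟩) with h0 | h1
      · refine absurd (le_bot_iff.mp ?_) hRne
        intro r hr
        obtain ⟨a, ha, v, hv, hav⟩ := Submodule.mem_sup.mp
          (hcompl.2 ▸ Submodule.mem_top : r ∈ g.toSubmodule ⊔ V)
        have hv' : v ∈ g.toSubmodule ⊔ R.toSubmodule := by
          rw [eq_sub_of_add_eq' hav, sub_eq_neg_add]
          exact Submodule.add_mem_sup (neg_mem ha) hr
        have hv0 : v = 0 := (Submodule.mem_bot ℝ).mp (h0 ▸ ⟨hv, hv'⟩)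
        rw [hv0, add_zero] at hav
        rw [← hgR]
        exact ⟨hav ▸ ha, hr⟩
      · rw [eq_top_iff, ← hcompl.2]
        exact sup_le le_sup_left (inf_eq_left.mp h1)
    have htopV : V ⊔ R.toSubmodule = ⊤ := by
      let J : LieIdeal ℝ g :=
        { (V ⊔ R.toSubmodule).comap g.toSubmodule.subtype with
          lie_mem := fun {x w} hw => hsup_stab (x : h) (hstab x x.2) (hRg x) w hw }
      have hJ (x : g) : x ∈ J ↔ (x : h) ∈ V ⊔ R.toSubmodule := Iff.rfl
      rcases LieAlgebra.IsSimple.eq_bot_or_eq_top J with h0 | h1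
      · refine absurd (le_bot_iff.mp ?_) hRne
        intro r hr
        obtain ⟨a, ha, v, hv, hav⟩ := Submodule.mem_sup.mp
          (hcompl.2 ▸ Submodule.mem_top : r ∈ g.toSubmodule ⊔ V)
        have ha' : (⟨a, ha⟩ : g) ∈ J := by
          rw [hJ, Subtype.coe_mk, eq_sub_of_add_eq hav, sub_eq_neg_add]
          exact Submodule.add_mem_sup (neg_mem hv) hr
        rw [h0, LieSubmodule.mem_bot] at ha'
        have ha0 : a = 0 := congrArg Subtype.val ha'
        rw [ha0, zero_add] at hav
        rw [← hbot]
        exact ⟨hav ▸ hv, hr⟩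
      · rw [eq_top_iff, ← hcompl.2]
        exact sup_le (fun x hx => (hJ ⟨x, hx⟩).mp (h1 ▸ LieSubmodule.mem_top _)) le_sup_left
    exact absurd (g.exists_equiv_of_isCompl V R hstab
      ⟨disjoint_iff.mpr hgR, codisjoint_iff.mpr htopg⟩
      ⟨disjoint_iff.mpr hbot, codisjoint_iff.mpr htopV⟩) hnotadj
  have hRV : R.toSubmodule = V := by
    refine le_antisymm (fun r hr => ?_) hVR
    obtain ⟨a, ha, v, hv, rfl⟩ := Submodule.mem_sup.mp
      (hcompl.2 ▸ Submodule.mem_top : r ∈ g.toSubmodule ⊔ V)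
    have haR : a ∈ R.toSubmodule := (Submodule.add_mem_iff_left _ (hVR hv)).mp hr
    have ha0 : a = 0 := (Submodule.mem_bot ℝ).mp (hgR ▸ ⟨ha, haR⟩)
    rwa [ha0, zero_add]
  refine ⟨hRV, fun v hv w hw => ?_, fun x v hv => hRV ▸ hRg x v (hRV.symm ▸ hv)⟩
  have hsolv : LieAlgebra.IsSolvable R := LieAlgebra.radicalIsSolvable ℝ h
  let A := LieAlgebra.derivedAbelianOfIdeal R
  have hAR : A ≤ R := by
    change LieAlgebra.derivedAbelianOfIdeal R ≤ R
    unfold LieAlgebra.derivedAbelianOfIdeal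
    split
    · exact bot_le
    · exact LieAlgebra.derivedSeriesOfIdeal_le_self R _
  have hAbel : IsLieAbelian A := LieAlgebra.abelian_derivedAbelianOfIdeal R
  have hAV : A.toSubmodule = V := by
    refine (hirrV A.toSubmodule (hRV ▸ hAR) fun x _ w hw => A.lie_mem hw).resolve_left
      fun hbot => hrad ?_
    exact (LieAlgebra.abelian_of_solvable_ideal_eq_bot_iff R).mp (by simpa using hbot)
  have hvA : v ∈ A.toSubmodule := hAV.symm ▸ hv
  have hwA : w ∈ A.toSubmodule := hAV.symm ▸ hw
  exact congrArg Subtype.val (hAbel.trivial (⟨v, hvA⟩ : A) ⟨w, hwA⟩)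
end
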